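/- For every integer r ≥ 1 there is a constant κ_r > 0 such that for every type r walk A on ℤ/nℤ (n ≥ π^r, generators a₁, …, a_r, |λ_m| = max_{k≠0}|λ_k| < 1), the mixing time satisfies t_A(1/2) ≤ 2π²(2r+1)κ_r / (−ln|λ_m|); consequently (1 − |λ_m|)·t_A(1/2) ≤ 2π²(2r+1)κ_r, i.e. the product of the spectral gap parameter and the mixing time is uniformly bounded over all type r walks. -/

import Mathlib

/-- Step distribution of the type `r` walk on `ZMod n` with step directions `a i`:
each of the elements `0, ±a i` is applied with probability `1/(2r+1)`
(multiplicities added when elements coincide). -/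
noncomputable def stepDist (n r : ℕ) (a : Fin r → ZMod n) : ZMod n → ℝ :=
  fun g => (1 / (2 * (r : ℝ) + 1)) *
    ((if g = 0 then 1 else 0) +
      ∑ i : Fin r, ((if g = a i then (1 : ℝ) else 0) + (if g = -a i then 1 else 0)))

/-- `t`-fold convolution power of a distribution `p` on `ZMod n`. -/
noncomputable def convPow (n : ℕ) [NeZero n] (p : ZMod n → ℝ) : ℕ → ZMod n → ℝ
  | 0 => fun g => if g = 0 then 1 else 0
  | t + 1 => fun g => ∑ h : ZMod n, p h * convPow n p t (g - h)

/-- Total variation distance of the type `r` walk from the uniform distribution after `t`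
steps: `d_A(t) = ∑_g |p^{*t}(g) − 1/n|`. -/
noncomputable def dTV (n r : ℕ) [NeZero n] (a : Fin r → ZMod n) (t : ℕ) : ℝ :=
  ∑ g : ZMod n, |convPow n (stepDist n r a) t g - 1 / (n : ℝ)|

/-- The eigenvalue `λ_k = (1/(2r+1))·(1 + 2·∑_{i} cos(2π·k·a_i/n))` of the type `r` walk. -/
noncomputable def walkEig (n r : ℕ) (a : Fin r → ZMod n) (k : ZMod n) : ℝ :=
  (1 / (2 * (r : ℝ) + 1)) *
    (1 + 2 * ∑ i : Fin r, Real.cos (2 * Real.pi * ((k * a i).val : ℝ) / n))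

open Finset in
theorem sum_sq_sum_mul_stdAddChar {n : ℕ} [NeZero n] (F : ZMod n → ℂ) (hF : ∀ k, F (-k) = F k) :
    ∑ g : ZMod n, (∑ k, F k * ZMod.stdAddChar (k * g)) ^ 2 = n * ∑ k, F k ^ 2 := by
  have orthogonality (k l : ZMod n) :
      ∑ g : ZMod n, ZMod.stdAddChar (k * g) * ZMod.stdAddChar (l * g) =
        if l = -k then (n : ℂ) else 0 := by
    simp_rw [← AddChar.map_add_eq_mul, ← add_mul, mul_comm _]
    rw [AddChar.sum_mulShift _ (ZMod.isPrimitive_stdAddChar n)]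
    simp [add_comm k l, add_eq_zero_iff_eq_neg, ZMod.card]
  calc ∑ g : ZMod n, (∑ k, F k * ZMod.stdAddChar (k * g)) ^ 2
      = ∑ g : ZMod n, ∑ k, ∑ l, F k * F l *
          (ZMod.stdAddChar (k * g) * ZMod.stdAddChar (l * g)) := by
        refine sum_congr rfl fun g _ => ?_
        rw [sq, sum_mul_sum]
        exact sum_congr rfl fun k _ => sum_congr rfl fun l _ => by ring
    _ = ∑ k, ∑ l, F k * F l *
          ∑ g : ZMod n, ZMod.stdAddChar (k * g) * ZMod.stdAddChar (l * g) := by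
        rw [sum_comm]
        refine sum_congr rfl fun k _ => ?_
        rw [sum_comm]
        exact sum_congr rfl fun l _ => by rw [mul_sum]
    _ = n * ∑ k, F k ^ 2 := by
        simp_rw [orthogonality, mul_ite, mul_zero, sum_ite_eq' univ, mem_univ, if_true, hF,
          mul_sum]
        exact sum_congr rfl fun k _ => by ring

theorem cos_val_cast {n : ℕ} [NeZero n] (z : ℤ) :
    Real.cos (2 * Real.pi * (((z : ZMod n)).val : ℝ) / n) =
      Real.cos (2 * Real.pi * ((z : ℝ) / n)) := by
  have hn : (n : ℝ) ≠ 0 := NeZero.ne _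
  have hval : (((z : ZMod n)).val : ℝ) = z - n * (z / n : ℤ) := by
    have h : (((z : ZMod n)).val : ℤ) = z % n := ZMod.val_intCast z
    rw [Int.emod_def] at h
    exact_mod_cast congrArg (Int.cast : ℤ → ℝ) h
  rw [hval, ← Real.cos_sub_int_mul_two_pi (2 * Real.pi * (z / n)) (z / n : ℤ)]
  congr 1
  field_simp

theorem stdAddChar_neg_add_stdAddChar {n : ℕ} [NeZero n] (x : ZMod n) :
    ZMod.stdAddChar (-x) + ZMod.stdAddChar x =
      2 * (Real.cos (2 * Real.pi * (x.val : ℝ) / n) : ℂ) := by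
  obtain ⟨z, rfl⟩ := ZMod.intCast_surjective x
  rw [cos_val_cast, ← Int.cast_neg, ZMod.stdAddChar_coe, ZMod.stdAddChar_coe, Complex.ofReal_cos,
    Complex.two_cos, add_comm]
  congr 2 <;> push_cast <;> ring

theorem walkEig_neg {n r : ℕ} [NeZero n] (a : Fin r → ZMod n) (k : ZMod n) :
    walkEig n r a (-k) = walkEig n r a k := by
  have h (x : ZMod n) : Real.cos (2 * Real.pi * ((-x).val : ℝ) / n) =
      Real.cos (2 * Real.pi * (x.val : ℝ) / n) := by
    obtain ⟨z, rfl⟩ := ZMod.intCast_surjective x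
    rw [← Int.cast_neg, cos_val_cast, cos_val_cast, ← Real.cos_neg]
    congr 1
    push_cast
    ring
  simp only [walkEig, neg_mul, h]

theorem walkEig_zero {n r : ℕ} [NeZero n] (a : Fin r → ZMod n) : walkEig n r a 0 = 1 := by
  have : (2 * (r : ℝ) + 1) ≠ 0 := by positivity
  simp [walkEig]
  field_simp
  ring

open Finset in
theorem sum_stepDist_mul_stdAddChar {n r : ℕ} [NeZero n] (a : Fin r → ZMod n) (k : ZMod n) :
    ∑ h : ZMod n, (stepDist n r a h : ℂ) * ZMod.stdAddChar (-(k * h)) = walkEig n r a k := by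
  have key : ∑ h : ZMod n, (stepDist n r a h : ℂ) * ZMod.stdAddChar (-(k * h)) =
      1 / (2 * r + 1) * (1 + ∑ i, (ZMod.stdAddChar (-(k * a i)) +
        ZMod.stdAddChar (k * a i))) := by
    simp only [stepDist]
    push_cast
    simp only [mul_assoc, ← mul_sum, add_mul, sum_add_distrib, sum_mul]
    rw [sum_comm, sum_comm (s := univ (α := ZMod n))]
    simp [apply_ite Complex.ofReal, add_comm]
  rw [key, walkEig]
  simp_rw [stdAddChar_neg_add_stdAddChar]
  push_cast
  rw [mul_sum]

open Finset in
theorem convPow_eq_sum_walkEig {n r : ℕ} [NeZero n] (a : Fin r → ZMod n) (t : ℕ) (g : ZMod n) :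
    (convPow n (stepDist n r a) t g : ℂ) =
      (1 / n) * ∑ k, (walkEig n r a k : ℂ) ^ t * ZMod.stdAddChar (k * g) := by
  have hn : (n : ℂ) ≠ 0 := NeZero.ne _
  induction t generalizing g with
  | zero =>
    simp only [convPow, pow_zero, one_mul]
    rw [AddChar.sum_mulShift _ (ZMod.isPrimitive_stdAddChar n), ZMod.card]
    split_ifs <;> simp [hn]
  | succ t ih =>
    simp only [convPow]
    push_cast
    simp_rw [ih, mul_sum]
    rw [sum_comm]
    refine sum_congr rfl fun k _ => ?_
    rw [pow_succ, ← sum_stepDist_mul_stdAddChar a k, mul_sum, sum_mul, mul_sum]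
    refine sum_congr rfl fun h _ => ?_
    rw [mul_sub, sub_eq_add_neg, AddChar.map_add_eq_mul]
    ring

open Finset in
/-- The Diaconis–Shahshahani upper bound lemma. -/
theorem dTV_sq_le {n r : ℕ} [NeZero n] (a : Fin r → ZMod n) (t : ℕ) :
    dTV n r a t ^ 2 ≤ ∑ k ∈ univ.erase (0 : ZMod n), walkEig n r a k ^ (2 * t) := by
  have hn : (n : ℂ) ≠ 0 := NeZero.ne _
  set F : ZMod n → ℂ := fun k => if k = 0 then 0 else (walkEig n r a k : ℂ) ^ t with hF
  have diff_eq (g : ZMod n) : ((convPow n (stepDist n r a) t g - 1 / n : ℝ) : ℂ) =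
      (1 / n) * ∑ k, F k * ZMod.stdAddChar (k * g) := by
    push_cast
    rw [convPow_eq_sum_walkEig, ← add_sum_erase _ _ (mem_univ (0 : ZMod n)),
      ← add_sum_erase _ (fun k => F k * _) (mem_univ (0 : ZMod n))]
    have : ∑ k ∈ univ.erase (0 : ZMod n), F k * ZMod.stdAddChar (k * g) =
        ∑ k ∈ univ.erase (0 : ZMod n), (walkEig n r a k : ℂ) ^ t * ZMod.stdAddChar (k * g) :=
      sum_congr rfl fun k hk => by simp [hF, ne_of_mem_erase hk]
    rw [this]
    simp [hF, walkEig_zero]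
    ring
  have parseval : n * ∑ g, (convPow n (stepDist n r a) t g - 1 / n) ^ 2 =
      ∑ k ∈ univ.erase (0 : ZMod n), walkEig n r a k ^ (2 * t) := by
    apply Complex.ofReal_injective
    rw [Complex.ofReal_mul, Complex.ofReal_sum, Complex.ofReal_sum]
    simp_rw [Complex.ofReal_pow, diff_eq, mul_pow, ← mul_sum]
    rw [sum_sq_sum_mul_stdAddChar F (fun k => by simp [hF, walkEig_neg]),
      ← add_sum_erase _ (fun k => F k ^ 2) (mem_univ (0 : ZMod n))]
    have : ∑ k ∈ univ.erase (0 : ZMod n), F k ^ 2 =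
        ∑ k ∈ univ.erase (0 : ZMod n), (walkEig n r a k : ℂ) ^ (2 * t) :=
      sum_congr rfl fun k hk => by simp [hF, ne_of_mem_erase hk, ← pow_mul, mul_comm]
    rw [this]
    simp only [hF, if_true, Complex.ofReal_natCast]
    field_simp
    ring
  rw [← parseval, dTV]
  refine (sq_sum_le_card_mul_sum_sq (s := univ)).trans_eq ?_
  simp [ZMod.card]

theorem summable_exp_neg_mul_abs_int {b : ℝ} (hb : 0 < b) :
    Summable fun m : ℤ => Real.exp (-b * |(m : ℝ)|) := by
  have h : Summable fun m : ℕ => Real.exp (-b * |((m : ℤ) : ℝ)|) := by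
    have := Real.summable_exp_nat_mul_iff.mpr (neg_lt_zero.mpr hb)
    refine this.congr fun m => ?_
    rw [Int.cast_natCast, Nat.abs_cast, mul_comm]
  exact Summable.of_nat_of_neg h (h.congr fun m => by simp)

theorem half_abs_floor_sub_one_le_sq (y : ℝ) : |(⌊y⌋ : ℝ)| / 2 - 1 ≤ y ^ 2 := by
  have h1 := Int.floor_le y
  have h2 := Int.lt_floor_add_one y
  rcases abs_cases (⌊y⌋ : ℝ) with ⟨h, _⟩ | ⟨h, _⟩ <;> rw [h] <;>
    nlinarith [sq_nonneg (y - 1 / 2), sq_nonneg (y + 1 / 2)]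

open Finset in
/-- A Gaussian sum over points of `ℝ^r` lying in pairwise distinct unit cells is bounded. -/
theorem sum_exp_neg_mul_sum_sq_le {K : Type*} [Fintype K] {r : ℕ} {b : ℝ} (hb : 0 < b)
    (y : K → Fin r → ℝ) (hy : Function.Injective fun k i => ⌊y k i⌋) :
    ∑ k, Real.exp (-b * ∑ i, y k i ^ 2) ≤
      (Real.exp b * ∑' m : ℤ, Real.exp (-(b / 2) * |(m : ℝ)|)) ^ r := by
  classical
  set f : ℤ → ℝ := fun m => Real.exp b * Real.exp (-(b / 2) * |(m : ℝ)|) with hf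
  have hf0 (m : ℤ) : 0 ≤ f m := by positivity
  have hfs : Summable f := (summable_exp_neg_mul_abs_int (half_pos hb)).mul_left _
  set S : Fin r → Finset ℤ := fun i => univ.image fun k => ⌊y k i⌋
  calc ∑ k, Real.exp (-b * ∑ i, y k i ^ 2)
      ≤ ∑ k, ∏ i, f ⌊y k i⌋ := by
        refine sum_le_sum fun k _ => ?_
        rw [mul_sum, Real.exp_sum]
        refine prod_le_prod (fun i _ => (Real.exp_pos _).le) fun i _ => ?_
        simp only [hf]
        rw [← Real.exp_add]
        refine Real.exp_le_exp.mpr ?_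
        nlinarith [half_abs_floor_sub_one_le_sq (y k i)]
    _ = ∑ p ∈ univ.image (fun k i => ⌊y k i⌋), ∏ i, f (p i) :=
        (sum_image (f := fun p : Fin r → ℤ => ∏ i, f (p i)) hy.injOn).symm
    _ ≤ ∑ p ∈ Fintype.piFinset S, ∏ i, f (p i) := by
        refine sum_le_sum_of_subset_of_nonneg ?_ fun p _ _ => prod_nonneg fun i _ => hf0 _
        intro p hp
        obtain ⟨k, -, rfl⟩ := mem_image.mp hp
        exact Fintype.mem_piFinset.mpr fun i => mem_image_of_mem _ (mem_univ k)
    _ = ∏ i, ∑ m ∈ S i, f m := (prod_univ_sum S fun _ => f).symm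
    _ ≤ ∏ _i : Fin r, ∑' m, f m :=
        prod_le_prod (fun i _ => sum_nonneg fun m _ => hf0 m)
          fun i _ => hfs.sum_le_tsum _ fun m _ => hf0 m
    _ = _ := by rw [prod_const, card_univ, Fintype.card_fin, hf, tsum_mul_left]

/-- The energy `∑ᵢ (1 - cos (2π k aᵢ / n))` of the character indexed by `k`. -/
noncomputable def walkEnergy (n r : ℕ) (a : Fin r → ZMod n) (k : ZMod n) : ℝ :=
  ∑ i : Fin r, (1 - Real.cos (2 * Real.pi * ((k * a i).val : ℝ) / n))

theorem one_sub_walkEig {n r : ℕ} (a : Fin r → ZMod n) (k : ZMod n) :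
    1 - walkEig n r a k = 2 / (2 * r + 1) * walkEnergy n r a k := by
  have : (2 * (r : ℝ) + 1) ≠ 0 := by positivity
  simp only [walkEig, walkEnergy, Finset.sum_sub_distrib, Finset.sum_const, Finset.card_univ,
    Fintype.card_fin, nsmul_eq_mul, mul_one]
  field_simp
  ring

theorem abs_walkEig_le {n r : ℕ} (hr : 1 ≤ r) (a : Fin r → ZMod n) (k : ZMod n) :
    |walkEig n r a k| ≤ Real.exp (-(1 / (r * (2 * r + 1))) * walkEnergy n r a k) := by
  have hr' : (1 : ℝ) ≤ r := by exact_mod_cast hr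
  have hq0 : 0 ≤ walkEnergy n r a k :=
    Finset.sum_nonneg fun i _ => sub_nonneg.mpr (Real.cos_le_one _)
  have hq2 : walkEnergy n r a k ≤ 2 * r := by
    refine (Finset.sum_le_sum (g := fun _ => (2 : ℝ)) fun i _ => ?_).trans_eq (by simp; ring)
    linarith [Real.neg_one_le_cos (2 * Real.pi * ((k * a i).val : ℝ) / n)]
  have h := one_sub_walkEig a k
  set q := walkEnergy n r a k
  have hexp := Real.add_one_le_exp (-(1 / (r * (2 * r + 1))) * q)
  refine le_trans ?_ hexp
  have e1 : 1 / (r * (2 * r + 1)) * q ≤ 2 / (2 * r + 1) * q := by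
    refine mul_le_mul_of_nonneg_right ?_ hq0
    rw [div_le_div_iff₀ (by positivity) (by positivity)]
    nlinarith
  have e2 : 1 / (r * (2 * r + 1)) * q ≤ 2 / (2 * r + 1) := by
    rw [div_mul_eq_mul_div, div_le_div_iff₀ (by positivity) (by positivity)]
    nlinarith
  have e3 : 2 / (2 * (r : ℝ) + 1) * q ≤ 2 - 2 / (2 * r + 1) := by
    have : 2 / (2 * (r : ℝ) + 1) * q ≤ 2 / (2 * r + 1) * (2 * r) := by gcongr
    refine this.trans_eq ?_
    field_simp
    ring
  rw [abs_le]
  constructor <;> linarith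

open Finset in
theorem sum_abs_walkEig_pow_le {n r : ℕ} [NeZero n] (hr : 1 ≤ r) (a : Fin r → ZMod n) {gap : ℝ}
    (hgap : 0 < gap) (hk : ∀ k, k ≠ 0 → gap ≤ 1 - walkEig n r a k) {t : ℕ}
    (ht : 1 / 2 ≤ t * gap) {b : ℝ} (hb : b = 1 / (Real.pi ^ 2 * r ^ 2)) :
    ∑ k, |walkEig n r a k| ^ t ≤
      (Real.exp b * ∑' m : ℤ, Real.exp (-(b / 2) * |(m : ℝ)|)) ^ r := by
  have hr' : (1 : ℝ) ≤ r := by exact_mod_cast hr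
  have hn : (0 : ℝ) < n := by exact_mod_cast NeZero.pos n
  have hπ := Real.pi_pos
  set x : ZMod n → Fin r → ℝ := fun k i => ((k * a i).valMinAbs : ℝ) / n with hx
  set δ : ℝ := √(gap * (2 * r + 1) / (4 * Real.pi ^ 2 * r)) with hδ
  have hδ0 : 0 < δ := by positivity
  have hδ2 : δ ^ 2 = gap * (2 * r + 1) / (4 * Real.pi ^ 2 * r) := Real.sq_sqrt (by positivity)
  have energy_ge (k : ZMod n) : 8 * ∑ i, x k i ^ 2 ≤ walkEnergy n r a k := by
    rw [mul_sum]
    refine sum_le_sum fun i _ => ?_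
    have hcast := cos_val_cast (n := n) (k * a i).valMinAbs
    rw [ZMod.coe_valMinAbs] at hcast
    have habs : |x k i| ≤ 1 / 2 := by
      have h : 2 * (k * a i).valMinAbs.natAbs ≤ n := by
        have := ZMod.natAbs_valMinAbs_le (k * a i)
        omega
      have h' : 2 * |((k * a i).valMinAbs : ℝ)| ≤ n := by
        have := Nat.cast_natAbs (α := ℝ) (k * a i).valMinAbs
        rw [← Int.cast_abs, ← this]
        exact_mod_cast h
      rw [hx, abs_div, abs_of_pos hn, div_le_iff₀ hn]
      linarith
    have := Real.cos_le_one_sub_mul_cos_sq (x := 2 * Real.pi * x k i) (by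
      rw [abs_mul, abs_of_pos (by positivity)]
      nlinarith)
    have e : 2 / Real.pi ^ 2 * (2 * Real.pi * x k i) ^ 2 = 8 * x k i ^ 2 := by
      field_simp
      ring
    rw [hcast]
    linarith
  have energy_sub_le (k l : ZMod n) :
      walkEnergy n r a (k - l) ≤ 2 * Real.pi ^ 2 * ∑ i, (x k i - x l i) ^ 2 := by
    rw [mul_sum]
    refine sum_le_sum fun i _ => ?_
    have hcast := cos_val_cast (n := n) ((k * a i).valMinAbs - (l * a i).valMinAbs)
    rw [Int.cast_sub, ZMod.coe_valMinAbs, ZMod.coe_valMinAbs, ← sub_mul, Int.cast_sub,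
      sub_div] at hcast
    rw [hcast]
    have := Real.one_sub_sq_div_two_le_cos (x := 2 * Real.pi * (x k i - x l i))
    simp only [hx] at this ⊢
    linarith
  have hinj : Function.Injective fun k i => ⌊x k i / δ⌋ := by
    intro k l hkl
    by_contra hne
    have h1 := hk (k - l) (sub_ne_zero.mpr hne)
    rw [one_sub_walkEig] at h1
    have h2 : ∑ i, (x k i - x l i) ^ 2 < ∑ _i : Fin r, δ ^ 2 := by
      have : (univ : Finset (Fin r)).Nonempty := ⟨⟨0, hr⟩, mem_univ _⟩
      refine sum_lt_sum_of_nonempty this fun i _ => ?_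
      have h3 := Int.abs_sub_lt_one_of_floor_eq_floor (congrFun hkl i)
      rw [← sub_div, abs_div, abs_of_pos hδ0, div_lt_one hδ0] at h3
      exact sq_lt_sq.mpr (by rwa [abs_of_pos hδ0])
    rw [sum_const, card_univ, Fintype.card_fin, nsmul_eq_mul, hδ2] at h2
    have h4 : 2 / (2 * (r : ℝ) + 1) * walkEnergy n r a (k - l) <
        2 / (2 * r + 1) * (2 * Real.pi ^ 2 *
          (r * (gap * (2 * r + 1) / (4 * Real.pi ^ 2 * r)))) := by
      gcongr
      exact (energy_sub_le k l).trans_lt (by gcongr)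
    have h5 : 2 / (2 * (r : ℝ) + 1) * (2 * Real.pi ^ 2 *
        (r * (gap * (2 * r + 1) / (4 * Real.pi ^ 2 * r)))) = gap := by
      field_simp
      ring
    linarith
  have hb0 : 0 < b := by rw [hb]; positivity
  refine le_trans (sum_le_sum fun k _ => ?_) (sum_exp_neg_mul_sum_sq_le hb0 _ hinj)
  refine (pow_le_pow_left₀ (abs_nonneg _) (abs_walkEig_le hr a k) t).trans ?_
  rw [← Real.exp_nat_mul]
  refine Real.exp_le_exp.mpr ?_
  simp_rw [div_pow, ← sum_div]
  set s := ∑ i, x k i ^ 2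
  have hs : 0 ≤ s := sum_nonneg fun i _ => sq_nonneg _
  have h1 : b * (s / δ ^ 2) ≤ t * gap * (2 * b * (s / δ ^ 2)) := by
    have : 0 ≤ b * (s / δ ^ 2) := by positivity
    nlinarith
  have h2 : t * gap * (2 * b * (s / δ ^ 2)) = t * (1 / (r * (2 * r + 1)) * (8 * s)) := by
    rw [hδ2, hb]
    field_simp
    ring
  have h3 : t * (1 / (r * (2 * r + 1)) * (8 * s)) ≤
      t * (1 / (r * (2 * r + 1)) * walkEnergy n r a k) := by
    gcongr
    exact energy_ge k
  linarith

open Finset in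
/-- For each number `r` of generators there is a uniform bound on `t · (-log |λ_m|)` over all
walks and all times `t` at which the walk is not yet mixed. -/
theorem exists_mul_neg_log_le (r : ℕ) (hr : 1 ≤ r) :
    ∃ K : ℝ, 0 < K ∧ ∀ (n : ℕ) [NeZero n] (a : Fin r → ZMod n) (lamm : ℝ),
      (∀ k, k ≠ 0 → |walkEig n r a k| ≤ lamm) → 0 < lamm → lamm < 1 →
      ∀ t : ℕ, 1 / 2 ≤ dTV n r a t → t * -Real.log lamm ≤ K := by
  obtain ⟨b, hb⟩ : ∃ b : ℝ, b = 1 / (Real.pi ^ 2 * r ^ 2) := ⟨_, rfl⟩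
  set B := (Real.exp b * ∑' m : ℤ, Real.exp (-(b / 2) * |(m : ℝ)|)) ^ r with hB
  refine ⟨max 1 (Real.log (4 * B)), by positivity, ?_⟩
  intro n _ a lamm hlam h0 h1 t ht
  by_contra! hK
  obtain ⟨hK1, hK2⟩ := max_lt_iff.mp hK
  have hlog : 0 < -Real.log lamm := neg_pos.mpr (Real.log_neg h0 h1)
  have ht1 : (1 : ℝ) ≤ t := by
    have : t ≠ 0 := by rintro rfl; norm_num at hK1
    exact_mod_cast Nat.one_le_iff_ne_zero.mpr this
  have hgap : 1 / 2 ≤ t * (1 - lamm) := by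
    have hpow : -Real.log lamm * lamm ≤ 1 - lamm := by
      have := Real.one_sub_inv_le_log_of_pos h0
      have : (1 - lamm⁻¹) * lamm ≤ Real.log lamm * lamm := by gcongr
      rw [sub_mul, inv_mul_cancel₀ h0.ne'] at this
      linarith
    rcases le_total lamm (1 / 2) with h | h
    · nlinarith
    · nlinarith
  have hsum := sum_abs_walkEig_pow_le hr a (sub_pos.mpr h1)
    (fun k hk => by linarith [hlam k hk, le_abs_self (walkEig n r a k)]) hgap hb
  rw [← hB] at hsum
  have hB0 : 0 < B := by
    refine lt_of_lt_of_le ?_ hsum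
    refine lt_of_lt_of_le ?_ (single_le_sum (f := fun k => |walkEig n r a k| ^ t)
      (fun k _ => by positivity) (mem_univ 0))
    simp [walkEig_zero]
  have hsmall : lamm ^ t * (4 * B) < 1 := by
    rw [← Real.exp_log h0, ← Real.exp_nat_mul, ← Real.exp_log (show 0 < 4 * B by positivity),
      ← Real.exp_add, Real.exp_lt_one_iff]
    linarith
  have hbound : dTV n r a t ^ 2 ≤ lamm ^ t * B := by
    refine (dTV_sq_le a t).trans ?_
    calc ∑ k ∈ univ.erase (0 : ZMod n), walkEig n r a k ^ (2 * t)
        ≤ ∑ k ∈ univ.erase (0 : ZMod n), lamm ^ t * |walkEig n r a k| ^ t := by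
          refine sum_le_sum fun k hk => ?_
          rw [← (even_two_mul t).pow_abs, two_mul, pow_add]
          gcongr
          exact hlam k (ne_of_mem_erase hk)
      _ = lamm ^ t * ∑ k ∈ univ.erase (0 : ZMod n), |walkEig n r a k| ^ t := by rw [mul_sum]
      _ ≤ lamm ^ t * B := by
          gcongr
          exact (sum_le_sum_of_subset_of_nonneg (erase_subset _ _)
            fun k _ _ => by positivity).trans hsum
  nlinarith

theorem dTV_eq_zero_of_walkEig_eq_zero {n r : ℕ} [NeZero n] (a : Fin r → ZMod n)
    (h : ∀ k, k ≠ 0 → walkEig n r a k = 0) {t : ℕ} (ht : t ≠ 0) : dTV n r a t = 0 := by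
  have := dTV_sq_le a t
  rw [Finset.sum_eq_zero fun k hk => by
    rw [h k (Finset.ne_of_mem_erase hk), zero_pow (by omega)]] at this
  exact pow_eq_zero_iff two_ne_zero |>.mp (this.antisymm (sq_nonneg _))

/-- For every `r ≥ 1` there is `κ_r > 0` such that every type `r` walk on `ℤ/nℤ`
(`n ≥ π^r`, generators `a₁, …, a_r`, `|λ_m| = max_{k≠0}|λ_k| < 1`) has mixing time
`t_A(1/2) ≤ 2π²(2r+1)κ_r/(−ln|λ_m|)`; consequently `(1 − |λ_m|)·t_A(1/2) ≤ 2π²(2r+1)κ_r`,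
so the product of the spectral gap parameter and the mixing time is uniformly bounded. -/
theorem mixing_time_spectral_gap_bound (r : ℕ) (hr : 1 ≤ r) :
    ∃ κ : ℝ, 0 < κ ∧
      ∀ (n : ℕ) [NeZero n] (a : Fin r → ZMod n), Real.pi ^ r ≤ (n : ℝ) →
        AddSubgroup.closure (Set.range a) = ⊤ →
        ∀ lamm : ℝ,
          IsGreatest {x : ℝ | ∃ k : ZMod n, k ≠ 0 ∧ x = |walkEig n r a k|} lamm →
          lamm < 1 →
          ∀ tHalf : ℕ,
            IsGreatest {t : ℕ | 1 / 2 ≤ dTV n r a t} tHalf →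
            (tHalf : ℝ) ≤ 2 * Real.pi ^ 2 * (2 * (r : ℝ) + 1) * κ / (-Real.log lamm) ∧
            (1 - lamm) * (tHalf : ℝ) ≤ 2 * Real.pi ^ 2 * (2 * (r : ℝ) + 1) * κ := by
  obtain ⟨K, hK0, hK⟩ := exists_mul_neg_log_le r hr
  have hπ := Real.pi_pos
  refine ⟨K / (2 * Real.pi ^ 2 * (2 * r + 1)), by positivity, ?_⟩
  intro n _ a _ _ lamm hlamm hlt tHalf htHalf
  rw [mul_div_cancel₀ K (by positivity)]
  have hle (k : ZMod n) (hk : k ≠ 0) : |walkEig n r a k| ≤ lamm := hlamm.2 ⟨k, hk, rfl⟩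
  have hlam0 : 0 ≤ lamm := by
    obtain ⟨k, -, rfl⟩ := hlamm.1
    exact abs_nonneg _
  rcases hlam0.eq_or_lt with rfl | hpos
  · have htz : tHalf = 0 := by
      by_contra hne
      have h := htHalf.1
      rw [Set.mem_ofPred_eq, dTV_eq_zero_of_walkEig_eq_zero a
        (fun k hk => abs_nonpos_iff.mp (hle k hk)) hne] at h
      norm_num at h
    subst htz
    simp [hK0.le]
  · have hlog : 0 < -Real.log lamm := neg_pos.mpr (Real.log_neg hpos hlt)
    have h := hK n a lamm hle hpos hlt tHalf htHalf.1
    refine ⟨(le_div_iff₀ hlog).mpr h, le_trans ?_ h⟩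
    rw [mul_comm]
    gcongr
    linarith [Real.log_le_sub_one_of_pos hpos]
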